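/- For every n ≥ 2, every real root λ̄ of the polynomial a_{n−1} satisfies |λ̄| < 2. -/

import Mathlib

namespace Ising

noncomputable section

open Matrix

/-- The polynomials `a_k(λ)`, defined by `a₋₁ = 0`, `a₀ = 1`, `a_k = λ a_{k-1} - a_{k-2}`
(so `a 1 = λ·a₀ - a₋₁ = λ`). -/
def aSeq (lam : ℝ) : ℕ → ℝ
  | 0 => 1
  | 1 => lam
  | k + 2 => lam * aSeq lam (k + 1) - aSeq lam k

theorem aSeq_growth (lam : ℝ) (h : 2 ≤ |lam|) (k : ℕ) :
    0 < |aSeq lam k| ∧ |aSeq lam k| < |aSeq lam (k + 1)| := by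
  induction k with
  | zero =>
    simp only [aSeq, abs_one]
    constructor <;> linarith
  | succ k ih =>
    obtain ⟨h0, h1⟩ := ih
    refine ⟨h0.trans h1, ?_⟩
    have e : aSeq lam (k + 1 + 1) = lam * aSeq lam (k + 1) - aSeq lam k := by
      simp only [aSeq]
    have h2 := abs_sub_abs_le_abs_sub (lam * aSeq lam (k + 1)) (aSeq lam k)
    rw [← e, abs_mul] at h2
    nlinarith [mul_le_mul_of_nonneg_right h (abs_nonneg (aSeq lam (k + 1)))]

/-- For every `n ≥ 2`, every real root `λ̄` of `a_{n-1}` satisfies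
`|λ̄| < 2`. -/
theorem stmt8 (n : ℕ) (hn : 2 ≤ n) (lam : ℝ) (hroot : aSeq lam (n - 1) = 0) :
    |lam| < 2 := by
  by_contra hc
  have h := (aSeq_growth lam (not_lt.mp hc) (n - 1)).1
  rw [hroot, abs_zero] at h
  exact lt_irrefl _ h

end
end Ising
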